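/- Low-Mach-number limit for the non-isentropic two-phase one-velocity system with algebraic pressure closure (order-by-order form of Proposition 3.3). Let d ≥ 1, γ₊, γ₋ > 1 and μ, λ ∈ ℝ. Let α₊⁰, α₋⁰, α₊¹, α₋¹, ρ₊⁰, ρ₋⁰, ρ₊¹, ρ₋¹, S₊⁰, S₋⁰, S₊¹, S₋¹ : ℝ × ℝ^d → ℝ and u⁰ : ℝ × ℝ^d → ℝ^d be smooth ℤ^d-periodic functions with ρ₊⁰ > 0 and ρ₋⁰ > 0 everywhere, and set p±⁰ := (ρ±⁰)^{γ±}e^{S±⁰} and π±¹ := p±⁰(γ± ρ±¹/ρ±⁰ + S±¹). Assume: (i) α₊⁰ + α₋⁰ = 1 and α₊¹ + α₋¹ = 0; (ii) p₊⁰ = p₋⁰ and π₊¹ = π₋¹; (iii) ∇(α₊⁰p₊⁰ + α₋⁰p₋⁰) = 0; (iv) ∂ₜ(α±⁰ρ±⁰) + div(α±⁰ρ±⁰u⁰) = 0 for both phases; (v) ∂ₜS±⁰ + u⁰·∇S±⁰ = 0 for both phases; (vi) ∂ₜ((α₊⁰ρ₊⁰+α₋⁰ρ₋⁰)u⁰)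 + div((α₊⁰ρ₊⁰+α₋⁰ρ₋⁰)u⁰⊗u⁰) + ∇(α₊⁰π₊¹ + α₋⁰π₋¹ + α₊¹p₊⁰ + α₋¹p₋⁰) = μΔu⁰ + (μ+λ)∇(div u⁰). Then: there is a constant C > 0 (in space and time) with p₊⁰ = p₋⁰ = C, hence ρ±⁰ = C^{1/γ±}e^{−S±⁰/γ±}; div u⁰ = 0; ∂ₜα₊⁰ + u⁰·∇α₊⁰ = 0; ∂ₜρ±⁰ + u⁰·∇ρ±⁰ = 0 for both phases; and ∂ₜ((α₊⁰ρ₊⁰+α₋⁰ρ₋⁰)u⁰) + div((α₊⁰ρ₊⁰+α₋⁰ρ₋⁰)u⁰⊗u⁰) + ∇π₊¹ = μΔu⁰. -/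

import Mathlib

open MeasureTheory Real

noncomputable section

/-- A space–time point: time in `ℝ`, space in `ℝ^d`. -/
abbrev Pt (d : ℕ) := ℝ × (Fin d → ℝ)

/-- Time derivative `∂ₜ f`. -/
def pt {d : ℕ} (f : Pt d → ℝ) (p : Pt d) : ℝ :=
  fderiv ℝ f p (1, 0)

/-- Spatial partial derivative `∂_{x i} f`. -/
def pd {d : ℕ} (i : Fin d) (f : Pt d → ℝ) (p : Pt d) : ℝ :=
  fderiv ℝ f p (0, Pi.single i 1)

/-- Spatial divergence of a vector field. -/
def divg {d : ℕ} (u : Pt d → Fin d → ℝ) (p : Pt d) : ℝ :=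
  ∑ i, pd i (fun q => u q i) p

/-- Spatial Laplacian of a scalar function. -/
def lap {d : ℕ} (f : Pt d → ℝ) (p : Pt d) : ℝ :=
  ∑ i, pd i (fun q => pd i f q) p

/-- `i`-th component of `div (r u ⊗ u)`, i.e. `∑ j ∂_{x j} (r u_i u_j)`. -/
def divT {d : ℕ} (r : Pt d → ℝ) (u : Pt d → Fin d → ℝ) (p : Pt d) (i : Fin d) : ℝ :=
  ∑ j, pd j (fun q => r q * u q i * u q j) p

/-- Symmetric gradient `D(u) = (∇u + (∇u)ᵀ)/2`. -/
def Dsym {d : ℕ} (u : Pt d → Fin d → ℝ) (p : Pt d) (i j : Fin d) : ℝ :=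
  (pd j (fun q => u q i) p + pd i (fun q => u q j) p) / 2

/-- Divergence of a matrix field, `i`-th component `∑ j ∂_{x j} M_{ij}`. -/
def divM {d : ℕ} (M : Pt d → Fin d → Fin d → ℝ) (p : Pt d) (i : Fin d) : ℝ :=
  ∑ j, pd j (fun q => M q i j) p

/-- `ℤ^d`-periodicity in the space variable. -/
def ZPeriodic {d : ℕ} (f : Pt d → ℝ) : Prop :=
  ∀ (k : Fin d → ℤ) (t : ℝ) (x : Fin d → ℝ), f (t, x + fun i => (k i : ℝ)) = f (t, x)

/-- `ℤ^d`-periodicity of a vector field. -/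
def ZPeriodicVec {d : ℕ} (u : Pt d → Fin d → ℝ) : Prop :=
  ∀ i, ZPeriodic (fun q => u q i)

/-- The unit cell `[0,1]^d`. -/
def cell (d : ℕ) : Set (Fin d → ℝ) := Set.Icc 0 1

section LowMach

variable {d : ℕ}

lemma fderiv_space_direction (f : Pt d → ℝ) (p : Pt d) (v : Fin d → ℝ) :
    fderiv ℝ f p (0, v) = ∑ i, v i * pd i f p := by
  have hsingle : ∀ i : Fin d, (fun j => if i = j then (1 : ℝ) else 0) = Pi.single i 1 := fun i => by
    ext j
    simp [Pi.single_apply, eq_comm]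
  simpa [pd, hsingle] using
    ((fderiv ℝ f p).comp (ContinuousLinearMap.inr ℝ ℝ (Fin d → ℝ))).toLinearMap.pi_apply_eq_sum_univ v

/-- The material derivative `∂ₜ f + v · ∇f` is a directional derivative in space–time. -/
lemma pt_add_sum_pd (f : Pt d → ℝ) (p : Pt d) (v : Fin d → ℝ) :
    pt f p + ∑ i, v i * pd i f p = fderiv ℝ f p (1, v) := by
  rw [← fderiv_space_direction, pt, ← map_add]
  simp

lemma pd_mul {f g : Pt d → ℝ} {p : Pt d} (i : Fin d) (hf : DifferentiableAt ℝ f p)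
    (hg : DifferentiableAt ℝ g p) :
    pd i (fun q => f q * g q) p = f p * pd i g p + g p * pd i f p := by
  simp [pd, fderiv_fun_mul hf hg]

lemma divg_mul {r : Pt d → ℝ} {u : Pt d → Fin d → ℝ} {p : Pt d}
    (hr : DifferentiableAt ℝ r p) (hu : ∀ i, DifferentiableAt ℝ (fun q => u q i) p) :
    divg (fun q j => r q * u q j) p = ∑ i, u p i * pd i r p + r p * divg u p := by
  simp only [divg, Finset.mul_sum, ← Finset.sum_add_distrib]
  refine Finset.sum_congr rfl fun i _ => ?_
  rw [pd_mul i hr (hu i)]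
  ring

lemma pt_add_divg_mul {r : Pt d → ℝ} {u : Pt d → Fin d → ℝ} {p : Pt d}
    (hr : DifferentiableAt ℝ r p) (hu : ∀ i, DifferentiableAt ℝ (fun q => u q i) p) :
    pt r p + divg (fun q j => r q * u q j) p = fderiv ℝ r p (1, u p) + r p * divg u p := by
  rw [divg_mul hr hu, ← pt_add_sum_pd]
  ring

lemma hasDerivAt_time {f : Pt d → ℝ} {t : ℝ} {x : Fin d → ℝ}
    (hf : DifferentiableAt ℝ f (t, x)) :
    HasDerivAt (fun s => f (s, x)) (pt f (t, x)) t :=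
  hf.hasFDerivAt.comp_hasDerivAt t ((hasDerivAt_id t).prodMk (hasDerivAt_const t x))

lemma hasFDerivAt_space {f : Pt d → ℝ} {t : ℝ} {x : Fin d → ℝ}
    (hf : DifferentiableAt ℝ f (t, x)) :
    HasFDerivAt (fun y => f (t, y))
      ((fderiv ℝ f (t, x)).comp (ContinuousLinearMap.inr ℝ ℝ (Fin d → ℝ))) x :=
  hf.hasFDerivAt.comp x (hasFDerivAt_prodMk_right t x)

lemma continuous_pt {f : Pt d → ℝ} (hf : ContDiff ℝ 1 f) : Continuous (pt f) :=
  (hf.continuous_fderiv (by simp)).clm_apply continuous_const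

lemma continuous_pd {f : Pt d → ℝ} (hf : ContDiff ℝ 1 f) (i : Fin d) : Continuous (pd i f) :=
  (hf.continuous_fderiv (by simp)).clm_apply continuous_const

lemma continuous_divg {u : Pt d → Fin d → ℝ} (hu : ∀ i, ContDiff ℝ 1 (fun q => u q i)) :
    Continuous (divg u) :=
  continuous_finsetSum _ fun i _ => continuous_pd (hu i) i

lemma integrableOn_cell {f : Pt d → ℝ} (hf : Continuous f) (t : ℝ) :
    IntegrableOn (fun x => f (t, x)) (cell d) :=
  (hf.comp (Continuous.prodMk_right t)).continuousOn.integrableOn_compact isCompact_Icc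

lemma integral_cell_one : ∫ _ in cell d, (1 : ℝ) = 1 := by
  have h : (volume : Measure (Fin d → ℝ)).real (cell d) = 1 := by
    rw [Measure.real, cell, Real.volume_Icc_pi_toReal zero_le_one]
    simp
  simp [h]

/-- The divergence of a periodic vector field has zero mean over the unit cell. -/
lemma integral_cell_divg_eq_zero {u : Pt d → Fin d → ℝ}
    (hu : ∀ i, ContDiff ℝ 1 (fun q => u q i)) (hper : ZPeriodicVec u) (t : ℝ) :
    ∫ x in cell d, divg u (t, x) = 0 := by
  rcases d with _ | n
  · simp [divg]
  have hdiff := fun i p => ((hu i).differentiable (by simp)) p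
  have key := integral_divergence_of_hasFDerivAt_off_countable' (E := ℝ)
    (0 : Fin (n + 1) → ℝ) 1 zero_le_one (fun i x => u (t, x) i)
    (fun i x => (fderiv ℝ (fun q => u q i) (t, x)).comp
      (ContinuousLinearMap.inr ℝ ℝ (Fin (n + 1) → ℝ))) ∅ Set.countable_empty
    (fun i => ((hu i).continuous.comp (Continuous.prodMk_right t)).continuousOn)
    (fun x _ i => hasFDerivAt_space (hdiff i (t, x)))
    (integrableOn_cell (continuous_divg hu) t)
  refine Eq.trans key (Finset.sum_eq_zero fun i _ => ?_)
  rw [sub_eq_zero]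
  refine integral_congr_ae (Filter.Eventually.of_forall fun x => ?_)
  have h := hper i (Pi.single i 1) t (i.insertNth 0 x)
  have hshift : (i.insertNth (0 : ℝ) x : Fin (n + 1) → ℝ) +
      (fun j => (((Pi.single i 1 : Fin (n + 1) → ℤ) j : ℤ) : ℝ)) = i.insertNth (1 : ℝ) x := by
    ext j
    refine i.succAboveCases ?_ (fun j => ?_) j <;> simp
  rw [hshift] at h
  exact h

/-- Differentiation in time of the integral over the unit cell. -/
lemma hasDerivAt_integral_cell {f : Pt d → ℝ} (hf : ContDiff ℝ 1 f) (t : ℝ) :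
    HasDerivAt (fun s => ∫ x in cell d, f (s, x)) (∫ x in cell d, pt f (t, x)) t := by
  have hc := continuous_pt hf
  obtain ⟨M, hM⟩ := ((isCompact_Icc (a := t - 1) (b := t + 1)).prod
    (isCompact_Icc (a := (0 : Fin d → ℝ)) (b := 1))).exists_bound_of_continuousOn hc.continuousOn
  refine (hasDerivAt_integral_of_dominated_loc_of_deriv_le (μ := volume.restrict (cell d))
    (s := Set.Icc (t - 1) (t + 1)) (F := fun s x => f (s, x)) (F' := fun s x => pt f (s, x))
    (bound := fun _ => M) (Icc_mem_nhds (by linarith) (by linarith))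
    (Filter.Eventually.of_forall fun s => (integrableOn_cell hf.continuous s).1)
    (integrableOn_cell hf.continuous t) (integrableOn_cell hc t).1 ?_
    (integrableOn_cell (continuous_const (y := M)) t) ?_).2
  · exact ae_restrict_of_forall_mem measurableSet_Icc fun x hx s hs => hM (s, x) ⟨hs, hx⟩
  · exact Filter.Eventually.of_forall fun x s _ =>
      hasDerivAt_time (hf.differentiable (by simp) _)

/-- The mean of a periodic density transported by a periodic field with the damping rate `c t`
solves the corresponding linear differential equation. -/
lemma hasDerivAt_integral_cell_of_transport {r : Pt d → ℝ} {u : Pt d → Fin d → ℝ} {c : ℝ → ℝ}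
    (hr : ContDiff ℝ 1 r) (hu : ∀ i, ContDiff ℝ 1 (fun q => u q i))
    (hrper : ZPeriodic r) (huper : ZPeriodicVec u)
    (h : ∀ p, pt r p + divg (fun q j => r q * u q j) p = -c p.1 * r p) (t : ℝ) :
    HasDerivAt (fun s => ∫ x in cell d, r (s, x)) (-c t * ∫ x in cell d, r (t, x)) t := by
  have hru : ∀ i, ContDiff ℝ 1 (fun q => r q * u q i) := fun i => hr.mul (hu i)
  have hruper : ZPeriodicVec (fun q j => r q * u q j) := fun i k s x => by
    simp only [hrper k s x, huper i k s x]
  convert hasDerivAt_integral_cell hr t using 1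
  rw [← integral_const_mul, ← add_zero (∫ x in cell d, pt r (t, x)),
    ← integral_cell_divg_eq_zero hru hruper t,
    ← integral_add (integrableOn_cell (continuous_pt hr) t)
      (integrableOn_cell (continuous_divg hru) t)]
  exact integral_congr_ae (Filter.Eventually.of_forall fun x => (h (t, x)).symm)

/-- If `A + B = 1` where `A` and `B` decay at the rates `k β` and `k δ`, then `k = 0`. -/
lemma rate_eq_zero_of_add_eq_one {A B k : ℝ → ℝ} {β δ : ℝ} (hβ : 0 < β) (hδ : 0 < δ)
    (hk : Continuous k) (hAB : ∀ t, A t + B t = 1)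
    (hA : ∀ t, HasDerivAt A (-(k t * β) * A t) t)
    (hB : ∀ t, HasDerivAt B (-(k t * δ) * B t) t) (t : ℝ) : k t = 0 := by
  by_contra hkt
  have hW : ∀ s, k s * (β * A s + δ * B s) = 0 := fun s => by
    have h1 := (hA s).add (hB s)
    rw [show A + B = fun _ => (1 : ℝ) from funext hAB] at h1
    linarith [h1.unique (hasDerivAt_const s 1)]
  have hev : (fun s => β * A s + δ * B s) =ᶠ[nhds t] fun _ => 0 := by
    filter_upwards [hk.continuousAt.eventually_ne hkt] with s hs
    exact (mul_eq_zero.1 (hW s)).resolve_left hs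
  have hd := (((hA t).const_mul β).add ((hB t).const_mul δ)).unique
    ((hasDerivAt_const t 0).congr_of_eventuallyEq hev)
  have hW0 : β * A t + δ * B t = 0 := hev.eq_of_nhds
  have hprod : k t * (β * δ) = 0 := by
    linear_combination hd + k t * (β + δ) * hW0 - k t * (β * δ) * hAB t
  exact (mul_ne_zero hkt (mul_pos hβ hδ).ne') hprod

lemma fderiv_pressure {ρ S : Pt d → ℝ} {γ : ℝ} {p : Pt d} (v : Pt d)
    (hρ : DifferentiableAt ℝ ρ p) (hS : DifferentiableAt ℝ S p) (hpos : 0 < ρ p) :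
    fderiv ℝ (fun q => ρ q ^ γ * Real.exp (S q)) p v =
      ρ p ^ γ * Real.exp (S p) * (γ * fderiv ℝ ρ p v / ρ p + fderiv ℝ S p v) := by
  have h := (hρ.hasFDerivAt.rpow_const (p := γ) (Or.inl hpos.ne')).mul hS.hasFDerivAt.exp
  rw [show (fun q => ρ q ^ γ * Real.exp (S q)) =
    (fun q => ρ q ^ γ) * fun q => Real.exp (S q) from rfl, h.fderiv]
  simp only [add_apply, smul_apply, smul_eq_mul,
    Real.rpow_sub_one hpos.ne']
  field_simp
  ring

/-- Along the flow of `u`, a phase whose entropy is transported and whose pressure has no spatial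
gradient satisfies `∂ₜ ρ + u · ∇ρ = (k / γ) ρ`, where `k` is the logarithmic time derivative of
the pressure. -/
lemma material_deriv_density {ρ S P : Pt d → ℝ} {γ k : ℝ} {p : Pt d} {v : Fin d → ℝ}
    (hρ : DifferentiableAt ℝ ρ p) (hS : DifferentiableAt ℝ S p) (hpos : 0 < ρ p) (hγ : 0 < γ)
    (hP : ∀ q, ρ q ^ γ * Real.exp (S q) = P q) (hgrad : ∀ i, pd i P p = 0)
    (hk : pt P p = k * P p) (hent : pt S p + ∑ i, v i * pd i S p = 0) :
    pt ρ p + ∑ i, v i * pd i ρ p = k * (1 / γ) * ρ p := by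
  have h := fderiv_pressure (γ := γ) (1, v) hρ hS hpos
  have hPpos : 0 < P p := by rw [← hP]; positivity
  rw [funext hP, hP, ← pt_add_sum_pd, ← pt_add_sum_pd, ← pt_add_sum_pd, hent, hk] at h
  simp only [hgrad, mul_zero, Finset.sum_const_zero, add_zero] at h
  rw [mul_comm k, mul_right_inj' hPpos.ne'] at h
  rw [h]
  field_simp

lemma transport_of_mass {α ρ : Pt d → ℝ} {u : Pt d → Fin d → ℝ} {c : ℝ} {p : Pt d}
    (hα : DifferentiableAt ℝ α p) (hρ : DifferentiableAt ℝ ρ p)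
    (hu : ∀ i, DifferentiableAt ℝ (fun q => u q i) p) (hpos : 0 < ρ p)
    (hDρ : pt ρ p + ∑ i, u p i * pd i ρ p = c * ρ p)
    (hmass : pt (fun q => α q * ρ q) p + divg (fun q j => α q * ρ q * u q j) p = 0) :
    pt α p + divg (fun q j => α q * u q j) p = -c * α p := by
  rw [pt_add_divg_mul (hα.fun_mul hρ) hu, fderiv_fun_mul hα hρ] at hmass
  simp only [add_apply, smul_apply, smul_eq_mul] at hmass
  rw [pt_add_sum_pd] at hDρ
  rw [pt_add_divg_mul hα hu]
  refine mul_left_cancel₀ hpos.ne' ?_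
  linear_combination hmass - α p * hDρ

lemma eq_of_pd_eq_zero {f : Pt d → ℝ} (hf : Differentiable ℝ f) (h : ∀ p i, pd i f p = 0)
    (t : ℝ) (x y : Fin d → ℝ) : f (t, x) = f (t, y) := by
  refine is_const_of_fderiv_eq_zero (𝕜 := ℝ) (f := fun z => f (t, z))
    (fun z => (hasFDerivAt_space (hf _)).differentiableAt) (fun z => ?_) x y
  rw [(hasFDerivAt_space (hf _)).fderiv]
  ext v
  simp [fderiv_space_direction, h]

lemma density_eq_of_pressure_eq {ρ S γ C : ℝ} (hρ : 0 < ρ) (hγ : 0 < γ)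
    (h : ρ ^ γ * Real.exp S = C) : ρ = C ^ (1 / γ) * Real.exp (-S / γ) := by
  rw [← h, Real.mul_rpow (by positivity) (by positivity), ← Real.rpow_mul hρ.le, ← Real.exp_mul,
    mul_one_div_cancel hγ.ne', Real.rpow_one, mul_assoc, ← Real.exp_add,
    show S * (1 / γ) + -S / γ = 0 by ring, Real.exp_zero, mul_one]

end LowMach

/-- low-Mach-number limit for the non-isentropic two-phase one-velocity
system with algebraic pressure closure (order-by-order form of Proposition 3.3).
Here `p±⁰ = (ρ±⁰)^{γ±} e^{S±⁰}` and `π±¹ = p±⁰ (γ± ρ±¹/ρ±⁰ + S±¹)` are written out. -/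
theorem lowMach_twoPhase_oneVelocity_nonisentropic_algebraic
    {d : ℕ} (hd : 1 ≤ d) (γp γm μ lam : ℝ) (hγp : 1 < γp) (hγm : 1 < γm)
    (αp0 αm0 αp1 αm1 ρp0 ρm0 ρp1 ρm1 Sp0 Sm0 Sp1 Sm1 : Pt d → ℝ)
    (u0 : Pt d → Fin d → ℝ)
    (hreg : ContDiff ℝ (⊤ : ℕ∞) αp0 ∧ ContDiff ℝ (⊤ : ℕ∞) αm0 ∧ ContDiff ℝ (⊤ : ℕ∞) αp1 ∧ ContDiff ℝ (⊤ : ℕ∞) αm1 ∧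
      ContDiff ℝ (⊤ : ℕ∞) ρp0 ∧ ContDiff ℝ (⊤ : ℕ∞) ρm0 ∧ ContDiff ℝ (⊤ : ℕ∞) ρp1 ∧ ContDiff ℝ (⊤ : ℕ∞) ρm1 ∧
      ContDiff ℝ (⊤ : ℕ∞) Sp0 ∧ ContDiff ℝ (⊤ : ℕ∞) Sm0 ∧ ContDiff ℝ (⊤ : ℕ∞) Sp1 ∧ ContDiff ℝ (⊤ : ℕ∞) Sm1 ∧
      ContDiff ℝ (⊤ : ℕ∞) u0)
    (hper : ZPeriodic αp0 ∧ ZPeriodic αm0 ∧ ZPeriodic αp1 ∧ ZPeriodic αm1 ∧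
      ZPeriodic ρp0 ∧ ZPeriodic ρm0 ∧ ZPeriodic ρp1 ∧ ZPeriodic ρm1 ∧
      ZPeriodic Sp0 ∧ ZPeriodic Sm0 ∧ ZPeriodic Sp1 ∧ ZPeriodic Sm1 ∧ ZPeriodicVec u0)
    (hρp : ∀ p, 0 < ρp0 p) (hρm : ∀ p, 0 < ρm0 p)
    -- (i)
    (hα0 : ∀ p, αp0 p + αm0 p = 1) (hα1 : ∀ p, αp1 p + αm1 p = 0)
    -- (ii)
    (hpeq0 : ∀ p, ρp0 p ^ γp * Real.exp (Sp0 p) = ρm0 p ^ γm * Real.exp (Sm0 p))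
    (hpeq1 : ∀ p,
      ρp0 p ^ γp * Real.exp (Sp0 p) * (γp * ρp1 p / ρp0 p + Sp1 p)
      = ρm0 p ^ γm * Real.exp (Sm0 p) * (γm * ρm1 p / ρm0 p + Sm1 p))
    -- (iii)
    (hgrad : ∀ p (i : Fin d),
      pd i (fun q => αp0 q * (ρp0 q ^ γp * Real.exp (Sp0 q))
        + αm0 q * (ρm0 q ^ γm * Real.exp (Sm0 q))) p = 0)
    -- (iv)
    (hmassp : ∀ p, pt (fun q => αp0 q * ρp0 q) p
      + divg (fun q j => αp0 q * ρp0 q * u0 q j) p = 0)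
    (hmassm : ∀ p, pt (fun q => αm0 q * ρm0 q) p
      + divg (fun q j => αm0 q * ρm0 q * u0 q j) p = 0)
    -- (v)
    (hentp : ∀ p : Pt d, pt Sp0 p + ∑ i, u0 p i * pd i Sp0 p = 0)
    (hentm : ∀ p : Pt d, pt Sm0 p + ∑ i, u0 p i * pd i Sm0 p = 0)
    -- (vi)
    (hmom : ∀ p (i : Fin d),
      pt (fun q => (αp0 q * ρp0 q + αm0 q * ρm0 q) * u0 q i) p
      + divT (fun q => αp0 q * ρp0 q + αm0 q * ρm0 q) u0 p i
      + pd i (fun q =>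
          αp0 q * (ρp0 q ^ γp * Real.exp (Sp0 q) * (γp * ρp1 q / ρp0 q + Sp1 q))
          + αm0 q * (ρm0 q ^ γm * Real.exp (Sm0 q) * (γm * ρm1 q / ρm0 q + Sm1 q))
          + αp1 q * (ρp0 q ^ γp * Real.exp (Sp0 q))
          + αm1 q * (ρm0 q ^ γm * Real.exp (Sm0 q))) p
      = μ * lap (fun q => u0 q i) p + (μ + lam) * pd i (divg u0) p) :
    -- conclusions
    (∃ C : ℝ, 0 < C ∧
      (∀ p : Pt d, ρp0 p ^ γp * Real.exp (Sp0 p) = C) ∧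
      (∀ p : Pt d, ρm0 p ^ γm * Real.exp (Sm0 p) = C) ∧
      (∀ p : Pt d, ρp0 p = C ^ (1 / γp) * Real.exp (-Sp0 p / γp)) ∧
      (∀ p : Pt d, ρm0 p = C ^ (1 / γm) * Real.exp (-Sm0 p / γm))) ∧
    (∀ p : Pt d, divg u0 p = 0) ∧
    (∀ p : Pt d, pt αp0 p + ∑ i, u0 p i * pd i αp0 p = 0) ∧
    (∀ p : Pt d, pt ρp0 p + ∑ i, u0 p i * pd i ρp0 p = 0) ∧
    (∀ p : Pt d, pt ρm0 p + ∑ i, u0 p i * pd i ρm0 p = 0) ∧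
    (∀ p (i : Fin d),
      pt (fun q => (αp0 q * ρp0 q + αm0 q * ρm0 q) * u0 q i) p
      + divT (fun q => αp0 q * ρp0 q + αm0 q * ρm0 q) u0 p i
      + pd i (fun q =>
          ρp0 q ^ γp * Real.exp (Sp0 q) * (γp * ρp1 q / ρp0 q + Sp1 q)) p
      = μ * lap (fun q => u0 q i) p) := by
  obtain ⟨hap, ham, -, -, hrp, hrm, -, -, hsp, hsm, -, -, hu⟩ := hreg
  obtain ⟨happer, hamper, -, -, -, -, -, -, -, -, -, -, huper⟩ := hper
  have hγp0 : 0 < γp := by linarith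
  have hγm0 : 0 < γm := by linarith
  have h1 : (1 : WithTop ℕ∞) ≤ ((⊤ : ℕ∞) : WithTop ℕ∞) := by exact_mod_cast le_top
  have hui : ∀ i, ContDiff ℝ 1 (fun q => u0 q i) := contDiff_pi.1 (hu.of_le h1)
  have hdu : ∀ p i, DifferentiableAt ℝ (fun q => u0 q i) p :=
    fun p i => (hui i).differentiable (by simp) p
  have hdap : Differentiable ℝ αp0 := hap.differentiable (by simp)
  have hdam : Differentiable ℝ αm0 := ham.differentiable (by simp)
  have hdrp : Differentiable ℝ ρp0 := hrp.differentiable (by simp)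
  have hdrm : Differentiable ℝ ρm0 := hrm.differentiable (by simp)
  have hdsp : Differentiable ℝ Sp0 := hsp.differentiable (by simp)
  have hdsm : Differentiable ℝ Sm0 := hsm.differentiable (by simp)
  obtain ⟨P, hP⟩ : ∃ P : Pt d → ℝ, ∀ q, ρp0 q ^ γp * Real.exp (Sp0 q) = P q := ⟨_, fun _ => rfl⟩
  have hPm : ∀ q, ρm0 q ^ γm * Real.exp (Sm0 q) = P q := fun q => (hpeq0 q).symm.trans (hP q)
  have hPpos : ∀ q, 0 < P q := fun q => by
    rw [← hP]
    exact mul_pos (Real.rpow_pos_of_pos (hρp q) _) (Real.exp_pos _)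
  have hPC : ContDiff ℝ 1 P := by
    rw [← funext hP]
    exact ((hrp.of_le h1).rpow_const_of_ne fun q => (hρp q).ne').mul (hsp.of_le h1).exp
  have hPd : Differentiable ℝ P := hPC.differentiable (by simp)
  have hPgrad : ∀ p i, pd i P p = 0 := fun p i => by
    rw [← hgrad p i]
    congr 1
    funext q
    rw [hP, hPm, ← add_mul, hα0, one_mul]
  have hPspace := eq_of_pd_eq_zero hPd hPgrad
  obtain ⟨k, hk⟩ : ∃ k : ℝ → ℝ, ∀ t, k t = pt P (t, 0) / P (t, 0) := ⟨_, fun _ => rfl⟩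
  have hkcont : Continuous k := by
    rw [funext hk]
    exact ((continuous_pt hPC).comp (Continuous.prodMk_left 0)).div
      (hPC.continuous.comp (Continuous.prodMk_left 0)) fun t => (hPpos _).ne'
  have hPt : ∀ p : Pt d, pt P p = k p.1 * P p := fun ⟨t, x⟩ => by
    have h := hasDerivAt_time (hPd (t, x))
    simp only [hPspace _ x 0] at h
    rw [h.unique (hasDerivAt_time (hPd (t, 0))), hk, hPspace t x 0,
      div_mul_cancel₀ _ (hPpos _).ne']
  have hDρp := fun p => material_deriv_density (v := u0 p) (hdrp p) (hdsp p) (hρp p) hγp0 hP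
    (hPgrad p) (hPt p) (hentp p)
  have hDρm := fun p => material_deriv_density (v := u0 p) (hdrm p) (hdsm p) (hρm p) hγm0 hPm
    (hPgrad p) (hPt p) (hentm p)
  have hTp := fun p => transport_of_mass (hdap p) (hdrp p) (hdu p) (hρp p) (hDρp p) (hmassp p)
  have hTm := fun p => transport_of_mass (hdam p) (hdrm p) (hdu p) (hρm p) (hDρm p) (hmassm p)
  have hk0 : ∀ t, k t = 0 := by
    refine rate_eq_zero_of_add_eq_one (one_div_pos.2 hγp0) (one_div_pos.2 hγm0) hkcont
      (A := fun t => ∫ x in cell d, αp0 (t, x)) (B := fun t => ∫ x in cell d, αm0 (t, x))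
      (fun t => ?_)
      (hasDerivAt_integral_cell_of_transport (c := fun t => k t * (1 / γp)) (hap.of_le h1) hui
        happer huper hTp)
      (hasDerivAt_integral_cell_of_transport (c := fun t => k t * (1 / γm)) (ham.of_le h1) hui
        hamper huper hTm)
    rw [← integral_add (integrableOn_cell hap.continuous t) (integrableOn_cell ham.continuous t)]
    simp only [hα0]
    exact integral_cell_one
  simp only [hk0, zero_mul, neg_zero] at hPt hDρp hDρm hTp hTm
  have hPconst : ∀ p, P p = P 0 := fun p =>
    is_const_of_fderiv_eq_zero (𝕜 := ℝ) hPd (fun q => by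
      ext <;> simp [fderiv_space_direction, hPgrad, ← pt.eq_1, hPt]) p 0
  have hdiv : ∀ p, divg u0 p = 0 := fun p => by
    have hp := hTp p
    have hm := hTm p
    rw [pt_add_divg_mul (hdap p) (hdu p)] at hp
    rw [pt_add_divg_mul (hdam p) (hdu p), show αm0 = fun q => 1 - αp0 q from
      funext fun q => by linarith [hα0 q], fderiv_const_sub] at hm
    simp only [neg_apply] at hm
    linear_combination hp + hm
  refine ⟨⟨P 0, hPpos 0, fun p => (hP p).trans (hPconst p), fun p => (hPm p).trans (hPconst p),
      fun p => density_eq_of_pressure_eq (hρp p) hγp0 ((hP p).trans (hPconst p)),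
      fun p => density_eq_of_pressure_eq (hρm p) hγm0 ((hPm p).trans (hPconst p))⟩,
    hdiv, fun p => ?_, hDρp, hDρm, fun p i => ?_⟩
  · have hp := hTp p
    rwa [pt_add_divg_mul (hdap p) (hdu p), hdiv, mul_zero, add_zero, ← pt_add_sum_pd] at hp
  · have h := hmom p i
    have hdiv0 : pd i (divg u0) p = 0 := by
      rw [funext hdiv]
      simp [pd]
    rw [hdiv0, mul_zero, add_zero] at h
    rw [← h]
    congr 2
    funext q
    rw [← hpeq1 q, hP, hPm]
    linear_combination (-P q * (γp * ρp1 q / ρp0 q + Sp1 q)) * hα0 q - P q * hα1 q
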